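/- For any M > 0, the set { f ∈ L²((0,∞)) : f absolutely continuous on every compact interval, f' ∈ L²((0,∞)), ∫₀^∞ |f'(ω)|² dω ≤ M, and ∫₀^∞ (ln ω)²|f(ω)|²/ω dω ≤ M·∫₀^∞ |f(ω)|²/ω dω + (∫₀^∞ (−ln ω)|f(ω)|²/ω dω)² } is closed in L²((0,∞)). -/

import Mathlib

open MeasureTheory Set Filter Topology
open scoped ENNReal Topology

noncomputable section

/-- Pointwise bound for `log²` near zero. -/
lemma wv_log_sq_le {x : ℝ} (h0 : 0 < x) (h1 : x ≤ 1) :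
    (Real.log x) ^ 2 ≤ 16 * x ^ (-(1/2) : ℝ) := by
  have h := Real.abs_log_mul_self_rpow_lt x (1/4) h0 h1 (by norm_num)
  have h2 : (Real.log x * x ^ (1/4 : ℝ)) ^ 2 ≤ 16 := by
    rw [← sq_abs]
    have := abs_nonneg (Real.log x * x ^ (1/4 : ℝ))
    have h' : |Real.log x * x ^ (1/4 : ℝ)| < 4 := by
      refine h.trans_le ?_
      norm_num
    nlinarith
  have e : (x ^ (1/4 : ℝ)) ^ 2 = x ^ (1/2 : ℝ) := by
    rw [← Real.rpow_natCast, ← Real.rpow_mul h0.le]; norm_num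
  rw [mul_pow, e] at h2
  rw [Real.rpow_neg h0.le, ← div_eq_mul_inv, le_div_iff₀ (Real.rpow_pos_of_pos h0 _)]
  exact h2

lemma wv_log_sq_le_of_one_le {x : ℝ} (h1 : 1 ≤ x) : (Real.log x) ^ 2 ≤ 4 * x := by
  have hx : 0 ≤ x := by linarith
  have h := Real.log_le_sub_one_of_pos (Real.sqrt_pos.2 (by linarith : 0 < x))
  have h2 : Real.log x = 2 * Real.log (Real.sqrt x) := by rw [Real.log_sqrt hx]; ring
  have h3 := Real.log_nonneg h1
  have h4 := Real.sq_sqrt hx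
  have h5 := Real.sqrt_nonneg x
  have : Real.log x ≤ 2 * Real.sqrt x := by linarith
  nlinarith

lemma wv_dom_integrable : IntegrableOn (fun x : ℝ => 1 + (Real.log x) ^ 2) (Ioc 0 1) volume := by
  have hr : IntegrableOn (fun x : ℝ => 1 + 16 * x ^ (-(1/2) : ℝ)) (Ioc 0 1) volume := by
    have := (intervalIntegral.intervalIntegrable_rpow' (a := 0) (b := 1) (r := -(1/2))
      (by norm_num)).1
    exact (integrableOn_const (by simp)).add (this.const_mul 16)
  refine Integrable.mono' hr ?_ ?_
  · exact (measurable_const.add (Real.measurable_log.pow_const 2)).aestronglyMeasurable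
  · filter_upwards [ae_restrict_mem measurableSet_Ioc] with x hx
    rw [Real.norm_of_nonneg (by positivity)]
    linarith [wv_log_sq_le hx.1 hx.2]

/-- Weights controlled near zero and bounded at infinity. -/
structure WVWeight (w : ℝ → ℝ) : Prop where
  meas : Measurable w
  zero : ∀ x ∈ Ioc (0:ℝ) 1, |w x| * x ≤ 1 + (Real.log x) ^ 2
  inf : ∀ x ∈ Ioi (1:ℝ), |w x| ≤ 4

lemma wv_w_inv : WVWeight (fun x => 1 / x) := by
  refine ⟨by fun_prop, fun x hx => ?_, fun x hx => ?_⟩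
  · have := hx.1
    rw [abs_of_pos (by positivity), one_div_mul_cancel this.ne']
    nlinarith [sq_nonneg (Real.log x)]
  · have hx : 1 < x := hx
    rw [abs_of_pos (by positivity), div_le_iff₀ (by linarith)]; linarith

lemma wv_w_log : WVWeight (fun x => Real.log x / x) := by
  refine ⟨by fun_prop, fun x hx => ?_, fun x hx => ?_⟩
  · have := hx.1
    rw [abs_div, abs_of_pos this, div_mul_cancel₀ _ this.ne']
    nlinarith [sq_nonneg (|Real.log x| - 1), sq_abs (Real.log x), sq_nonneg (Real.log x)]
  · have hx : 1 < x := hx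
    rw [abs_div, abs_of_pos (by linarith : 0 < x), div_le_iff₀ (by linarith),
      abs_of_nonneg (Real.log_nonneg hx.le)]
    linarith [Real.log_le_sub_one_of_pos (by linarith : 0 < x)]

lemma wv_w_sq : WVWeight (fun x => (Real.log x) ^ 2 / x) := by
  refine ⟨by fun_prop, fun x hx => ?_, fun x hx => ?_⟩
  · have := hx.1
    rw [abs_div, abs_of_pos this, div_mul_cancel₀ _ this.ne', abs_of_nonneg (sq_nonneg _)]
    linarith
  · have hx : 1 < x := hx
    rw [abs_div, abs_of_pos (by linarith : 0 < x), div_le_iff₀ (by linarith),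
      abs_of_nonneg (sq_nonneg _)]
    exact wv_log_sq_le_of_one_le hx.le

lemma wv_dom {w : ℝ → ℝ} (hw : WVWeight w) {M : ℝ} {f : ℝ → ℂ}
    (hb : ∀ x, 0 < x → ‖f x‖ ^ 2 ≤ M * x) {x : ℝ} (hx : x ∈ Ioc (0:ℝ) 1) :
    ‖w x * ‖f x‖ ^ 2‖ ≤ M * (1 + (Real.log x) ^ 2) := by
  have h1 := hb x hx.1
  have h2 := hw.zero x hx
  have hM : 0 ≤ M := by
    by_contra h
    nlinarith [sq_nonneg ‖f x‖, hx.1]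
  rw [norm_mul, Real.norm_eq_abs, Real.norm_of_nonneg (sq_nonneg _)]
  calc |w x| * ‖f x‖ ^ 2 ≤ |w x| * (M * x) := by gcongr
    _ = M * (|w x| * x) := by ring
    _ ≤ _ := by gcongr

lemma wv_int0 {w : ℝ → ℝ} (hw : WVWeight w) {M : ℝ} {f : ℝ → ℂ} (hf : MemLp f 2 volume)
    (hb : ∀ x, 0 < x → ‖f x‖ ^ 2 ≤ M * x) :
    IntegrableOn (fun x => w x * ‖f x‖ ^ 2) (Ioc 0 1) volume := by
  refine Integrable.mono' (wv_dom_integrable.const_mul M) ?_ ?_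
  · exact (hw.meas.aestronglyMeasurable.mul (hf.1.norm.pow 2)).restrict
  · filter_upwards [ae_restrict_mem measurableSet_Ioc] with x hx
    exact wv_dom hw hb hx

lemma wv_int1 {w : ℝ → ℝ} (hw : WVWeight w) {f : ℝ → ℂ} (hf : MemLp f 2 volume) :
    IntegrableOn (fun x => w x * ‖f x‖ ^ 2) (Ioi 1) volume := by
  refine Integrable.mono' ((hf.norm.integrable_sq.const_mul 4).restrict (s := Ioi 1)) ?_ ?_
  · exact (hw.meas.aestronglyMeasurable.mul (hf.1.norm.pow 2)).restrict
  · filter_upwards [ae_restrict_mem measurableSet_Ioi] with x hx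
    rw [norm_mul, Real.norm_eq_abs, Real.norm_of_nonneg (sq_nonneg _)]
    have := hw.inf x hx
    gcongr

lemma wv_int {w : ℝ → ℝ} (hw : WVWeight w) {M : ℝ} {f : ℝ → ℂ} (hf : MemLp f 2 volume)
    (hb : ∀ x, 0 < x → ‖f x‖ ^ 2 ≤ M * x) :
    IntegrableOn (fun x => w x * ‖f x‖ ^ 2) (Ioi 0) volume := by
  rw [← Ioc_union_Ioi_eq_Ioi zero_le_one]
  exact (wv_int0 hw hf hb).union (wv_int1 hw hf)

lemma wv_tendsto {w : ℝ → ℝ} (hw : WVWeight w) {M : ℝ} {f : ℝ → ℂ} (hf : MemLp f 2 volume)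
    (hb : ∀ x, 0 < x → ‖f x‖ ^ 2 ≤ M * x) {fn : ℕ → ℝ → ℂ} (hfn : ∀ n, MemLp (fn n) 2 volume)
    (hbn : ∀ n x, 0 < x → ‖fn n x‖ ^ 2 ≤ M * x)
    (hae : ∀ᵐ x, Tendsto (fun n => fn n x) atTop (𝓝 (f x)))
    (hL : Tendsto (fun n => eLpNorm (fn n - f) 2 volume) atTop (𝓝 0)) :
    Tendsto (fun n => ∫ x in Ioi (0:ℝ), w x * ‖fn n x‖ ^ 2) atTop
      (𝓝 (∫ x in Ioi (0:ℝ), w x * ‖f x‖ ^ 2)) := by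
  have hs : ∀ g : ℝ → ℂ, MemLp g 2 volume → (∀ x, 0 < x → ‖g x‖ ^ 2 ≤ M * x) →
      ∫ x in Ioi (0:ℝ), w x * ‖g x‖ ^ 2 =
        (∫ x in Ioc (0:ℝ) 1, w x * ‖g x‖ ^ 2) + ∫ x in Ioi (1:ℝ), w x * ‖g x‖ ^ 2 := by
    intro g hg hgb
    rw [← Ioc_union_Ioi_eq_Ioi (zero_le_one (α := ℝ))]
    exact setIntegral_union (Ioc_disjoint_Ioi le_rfl) measurableSet_Ioi (wv_int0 hw hg hgb)
      (wv_int1 hw hg)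
  rw [hs f hf hb]
  simp_rw [fun n => hs (fn n) (hfn n) (hbn n)]
  refine Tendsto.add ?_ ?_
  · refine tendsto_integral_of_dominated_convergence (fun x => M * (1 + (Real.log x) ^ 2))
      (fun n => (wv_int0 hw (hfn n) (hbn n)).1) (wv_dom_integrable.const_mul M) ?_ ?_
    · intro n
      filter_upwards [ae_restrict_mem measurableSet_Ioc] with x hx
      exact wv_dom hw (hbn n) hx
    · filter_upwards [ae_restrict_of_ae hae] with x hx
      exact (hx.norm.pow 2).const_mul _
  · refine tendsto_integral_of_L1' _ (wv_int1 hw hf).1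
      (Eventually.of_forall fun n => wv_int1 hw (hfn n)) ?_
    set d : ℕ → ℝ → ℝ := fun n x => ‖(fn n - f) x‖ with hd
    set b : ℝ → ℝ := fun x => 2 * ‖f x‖ with hbdef
    have hbm : MemLp b 2 volume := hf.norm.const_mul 2
    have hdm : ∀ n, MemLp (d n) 2 volume := fun n => ((hfn n).sub hf).norm
    have hdn : ∀ n, eLpNorm (d n) 2 volume = eLpNorm (fn n - f) 2 volume := fun n =>
      eLpNorm_norm _
    have key : ∀ n, eLpNorm ((fun x => w x * ‖fn n x‖ ^ 2) - fun x => w x * ‖f x‖ ^ 2) 1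
        (volume.restrict (Ioi 1)) ≤ ((4 : NNReal) : ℝ≥0∞) * eLpNorm (fn n - f) 2 volume *
          (eLpNorm (fn n - f) 2 volume + eLpNorm b 2 volume) := by
      intro n
      calc _ ≤ eLpNorm (fun x => 4 * (d n x * (d n + b) x)) 1 (volume.restrict (Ioi 1)) := by
            refine eLpNorm_mono_ae ?_
            filter_upwards [ae_restrict_mem measurableSet_Ioi] with x hx
            have h4 := hw.inf x hx
            have ht : |‖fn n x‖ - ‖f x‖| ≤ d n x := abs_norm_sub_norm_le _ _
            have h0 : 0 ≤ d n x := norm_nonneg _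
            have hf0 : 0 ≤ ‖f x‖ := norm_nonneg _
            have hf1 : 0 ≤ ‖fn n x‖ := norm_nonneg _
            have hsum : ‖fn n x‖ + ‖f x‖ ≤ d n x + b x := by
              have := (abs_le.1 ht).2
              simp only [hbdef]; linarith
            have e : w x * ‖fn n x‖ ^ 2 - w x * ‖f x‖ ^ 2 =
              w x * ((‖fn n x‖ - ‖f x‖) * (‖fn n x‖ + ‖f x‖)) := by ring
            have hb0 : 0 ≤ d n x + b x := by linarith
            simp only [Pi.sub_apply, Pi.add_apply]
            rw [e, Real.norm_eq_abs, Real.norm_of_nonneg (by positivity), abs_mul, abs_mul,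
              abs_of_nonneg (add_nonneg hf1 hf0)]
            gcongr
        _ ≤ eLpNorm (fun x => 4 * (d n x * (d n + b) x)) 1 volume :=
            eLpNorm_mono_measure _ Measure.restrict_le_self
        _ ≤ ((4 : NNReal) : ℝ≥0∞) * eLpNorm (d n) 2 volume * eLpNorm (d n + b) 2 volume := by
            refine eLpNorm_le_eLpNorm_mul_eLpNorm'_of_norm (hdm n).1 ((hdm n).add hbm).1
              (fun u v => 4 * (u * v)) 4 (Eventually.of_forall fun x => ?_)
            rw [norm_mul, norm_mul, mul_assoc]; simp
        _ ≤ _ := by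
            rw [← hdn]
            gcongr
            exact eLpNorm_add_le (hdm n).1 hbm.1 (by norm_num)
    refine tendsto_of_tendsto_of_tendsto_of_le_of_le tendsto_const_nhds ?_ (fun _ => zero_le) key
    have h1 : Tendsto (fun n => ((4 : NNReal) : ℝ≥0∞) * eLpNorm (fn n - f) 2 volume) atTop
        (𝓝 0) := by
      simpa using ENNReal.Tendsto.const_mul hL (Or.inr (ENNReal.coe_ne_top (r := 4)))
    have h2 := hL.add (tendsto_const_nhds (x := eLpNorm b 2 volume))
    have h3 := ENNReal.Tendsto.mul h1 (Or.inr (by simpa using hbm.2.ne)) h2 (Or.inr (by simp))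
    simpa using h3

/-- The Hilbert space of derivatives. -/
abbrev WVH := Lp ℂ 2 (volume.restrict (Ioi (0:ℝ)))

/-- The indicator of `(0,x]`. -/
def wvInd (x : ℝ) : WVH :=
  indicatorConstLp 2 (measurableSet_Ioc (a := (0:ℝ)) (b := x))
    (ne_top_of_le_ne_top (by simp) (Measure.restrict_apply_le _ _) :
      (volume.restrict (Ioi (0:ℝ))) (Ioc 0 x) ≠ ⊤) 1

lemma wv_inner (x : ℝ) (hx : 0 ≤ x) (G : WVH) {g : ℝ → ℂ}
    (hg : G =ᵐ[volume.restrict (Ioi (0:ℝ))] g) :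
    inner ℂ (wvInd x) G = ∫ t in (0:ℝ)..x, g t := by
  rw [wvInd, L2.inner_indicatorConstLp_one, intervalIntegral.integral_of_le hx,
    Measure.restrict_restrict measurableSet_Ioc, inter_eq_left.2 Ioc_subset_Ioi_self]
  exact integral_congr_ae (ae_restrict_of_ae_restrict_of_subset Ioc_subset_Ioi_self hg)

lemma wv_norm_ind (x : ℝ) (hx : 0 ≤ x) : ‖wvInd x‖ ^ 2 = x := by
  rw [wvInd, norm_indicatorConstLp (by norm_num) (by norm_num)]
  have : (volume.restrict (Ioi (0:ℝ))).real (Ioc 0 x) = x := by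
    rw [measureReal_restrict_apply measurableSet_Ioc, inter_eq_left.2 Ioc_subset_Ioi_self]
    simp [hx]
  rw [this, norm_one, one_mul, ← Real.rpow_natCast, ← Real.rpow_mul hx]
  norm_num

lemma wv_norm_sq (G : WVH) {g : ℝ → ℂ} (hg : G =ᵐ[volume.restrict (Ioi (0:ℝ))] g) :
    ‖G‖ ^ 2 = ∫ x in Ioi (0:ℝ), ‖g x‖ ^ 2 := by
  have h := inner_self_eq_norm_sq_to_K (𝕜 := ℂ) G
  rw [L2.inner_def] at h
  have h2 : ∫ a in Ioi (0:ℝ), inner ℂ (G a) (G a) = ((∫ a in Ioi (0:ℝ), ‖g a‖ ^ 2 : ℝ) : ℂ) := by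
    rw [← integral_complex_ofReal]
    refine integral_congr_ae ?_
    filter_upwards [hg] with a ha
    rw [ha, inner_self_eq_norm_sq_to_K]; simp
  rw [h2] at h
  apply Complex.ofReal_injective
  rw [h]; simp

lemma wv_bound {M : ℝ} (G : WVH) {g : ℝ → ℂ} (hg : G =ᵐ[volume.restrict (Ioi (0:ℝ))] g)
    (hM : ‖G‖ ^ 2 ≤ M) (x : ℝ) (hx : 0 < x) : ‖∫ t in (0:ℝ)..x, g t‖ ^ 2 ≤ M * x := by
  rw [← wv_inner x hx.le G hg]
  calc _ ≤ (‖wvInd x‖ * ‖G‖) ^ 2 := by gcongr; exact norm_inner_le_norm _ _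
    _ = ‖G‖ ^ 2 * x := by rw [mul_pow, wv_norm_ind x hx.le]; ring
    _ ≤ _ := by gcongr

lemma wv_weak {M : ℝ} (G : ℕ → WVH) (hG : ∀ n, ‖G n‖ ^ 2 ≤ M) :
    ∃ H : WVH, ‖H‖ ^ 2 ≤ M ∧ ∀ v : WVH,
      Tendsto (fun n => inner ℂ v (G n)) (hyperfilter ℕ : Filter ℕ) (𝓝 (inner ℂ v H)) := by
  have hM : 0 ≤ M := (sq_nonneg _).trans (hG 0)
  let φ : ℕ → WeakDual ℂ WVH := fun n =>
    StrongDual.toWeakDual (InnerProductSpace.toDual ℂ WVH (G n))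
  have hc := WeakDual.isCompact_closedBall (𝕜 := ℂ) (E := WVH) 0 (Real.sqrt M)
  obtain ⟨Φ, hΦ, hlim⟩ := hc.ultrafilter_le_nhds ((hyperfilter ℕ).map φ) (by
    rw [le_principal_iff]
    refine Ultrafilter.mem_map.2 (Eventually.of_forall fun n => ?_)
    change InnerProductSpace.toDual ℂ WVH (G n) ∈ Metric.closedBall 0 (Real.sqrt M)
    rw [mem_closedBall_zero_iff, LinearIsometryEquiv.norm_map]
    exact Real.le_sqrt_of_sq_le (hG n))
  refine ⟨(InnerProductSpace.toDual ℂ WVH).symm (WeakDual.toStrongDual Φ), ?_, fun v => ?_⟩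
  · rw [LinearIsometryEquiv.norm_map]
    have := mem_closedBall_zero_iff.1 hΦ
    exact (Real.le_sqrt (norm_nonneg _) hM).1 this
  · have h1 : Tendsto φ (hyperfilter ℕ : Filter ℕ) (𝓝 Φ) := hlim
    have h2 := ((WeakDual.eval_continuous v).tendsto Φ).comp h1
    have h3 : Tendsto (fun n => inner ℂ (G n) v) (hyperfilter ℕ : Filter ℕ)
        (𝓝 (inner ℂ ((InnerProductSpace.toDual ℂ WVH).symm (WeakDual.toStrongDual Φ)) v)) := by
      rw [InnerProductSpace.toDual_symm_apply]
      refine h2.congr fun n => ?_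
      exact InnerProductSpace.toDual_apply_apply
    have h4 := (Complex.continuous_conj.tendsto _).comp h3
    rw [inner_conj_symm] at h4
    refine h4.congr fun n => ?_
    exact inner_conj_symm _ _

/-- For any `M > 0`, the set of `f ∈ L²((0,∞))` that are absolutely continuous on
every compact interval (with derivative `g`, encoded by `f x = ∫₀ˣ g`), with
`f' ∈ L²((0,∞))`, `∫₀^∞ |f'(ω)|² dω ≤ M`, and satisfying the window-space
variance bound
`∫₀^∞ (ln ω)²|f(ω)|²/ω dω ≤ M·∫₀^∞ |f(ω)|²/ω dω + (∫₀^∞ (−ln ω)|f(ω)|²/ω dω)²`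
(the left-hand integral taken in the extended sense, the middle integral
absolutely convergent), is closed in `L²((0,∞))`. -/
theorem isClosed_window_variance_set (M : ℝ) (hM : 0 < M) :
    IsClosed {F : Lp ℂ 2 (volume : Measure ℝ) |
      ∃ f g : ℝ → ℂ, (⇑F =ᵐ[volume] f) ∧
        (∀ x : ℝ, x ≤ 0 → f x = 0) ∧
        (∀ x : ℝ, IntervalIntegrable g volume 0 x) ∧
        (∀ x : ℝ, f x = ∫ t in (0:ℝ)..x, g t) ∧
        MemLp g 2 (volume.restrict (Set.Ioi (0:ℝ))) ∧
        (∫ ω in Set.Ioi (0:ℝ), ‖g ω‖ ^ 2 ≤ M) ∧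
        IntegrableOn (fun ω : ℝ => Real.log ω * ‖f ω‖ ^ 2 / ω) (Set.Ioi 0) volume ∧
        (∫⁻ ω in Set.Ioi (0:ℝ), ENNReal.ofReal ((Real.log ω) ^ 2 * ‖f ω‖ ^ 2 / ω)
          ≤ ENNReal.ofReal (M * (∫ ω in Set.Ioi (0:ℝ), ‖f ω‖ ^ 2 / ω) +
              (∫ ω in Set.Ioi (0:ℝ), (-Real.log ω) * ‖f ω‖ ^ 2 / ω) ^ 2))} := by
  refine IsSeqClosed.isClosed fun F₀ F hF₀ hlim₀ => ?_
  obtain ⟨ns, hns, hae⟩ := (tendstoInMeasure_of_tendsto_Lp hlim₀).exists_seq_tendsto_ae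
  have hlim := hlim₀.comp hns.tendsto_atTop
  have hF := fun n => hF₀ (ns n)
  choose f g hFf hf0 hgi hfg hgL hgM hlog hvar using hF
  have hG : ∀ n, (hgL n).toLp =ᵐ[volume.restrict (Ioi (0:ℝ))] g n := fun n => (hgL n).coeFn_toLp
  have hGM : ∀ n, ‖(hgL n).toLp‖ ^ 2 ≤ M := fun n => by
    rw [wv_norm_sq _ (hG n)]; exact hgM n
  obtain ⟨H, hHM, hweak⟩ := wv_weak (fun n => (hgL n).toLp) hGM
  set h : ℝ → ℂ := (Ioi (0:ℝ)).indicator H with hh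
  have hHh : H =ᵐ[volume.restrict (Ioi (0:ℝ))] h := by
    filter_upwards [ae_restrict_mem measurableSet_Ioi] with x hx
    rw [hh, indicator_of_mem hx]
  have hhL : MemLp h 2 volume := (memLp_indicator_iff_restrict measurableSet_Ioi).2 (Lp.memLp H)
  have hhi : ∀ x, IntervalIntegrable h volume 0 x := fun x =>
    ((hhL.locallyIntegrable (by norm_num)).integrableOn_isCompact isCompact_uIcc).intervalIntegrable
  set k : ℝ → ℂ := fun x => ∫ t in (0:ℝ)..x, h t with hk
  have hk0 : ∀ x, x ≤ 0 → k x = 0 := by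
    intro x hx
    rw [hk]
    simp only
    rw [intervalIntegral.integral_symm, intervalIntegral.integral_of_le hx, neg_eq_zero]
    refine setIntegral_eq_zero_of_forall_eq_zero fun t ht => ?_
    rw [hh, indicator_of_notMem]
    exact fun h' => not_lt.2 ht.2 h'
  have hfk : ∀ x, Tendsto (fun n => f n x) (hyperfilter ℕ : Filter ℕ) (𝓝 (k x)) := by
    intro x
    rcases le_total x 0 with hx | hx
    · rw [hk0 x hx]
      simp_rw [fun n => hf0 n x hx]
      exact tendsto_const_nhds
    · have := hweak (wvInd x)
      simp_rw [fun n => wv_inner x hx _ (hG n), wv_inner x hx H hHh, ← hfg] at this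
      exact this
  have hfall : ∀ᵐ x, ∀ n, F₀ (ns n) x = f n x := ae_all_iff.2 hFf
  have hle : (hyperfilter ℕ : Filter ℕ) ≤ atTop := by
    rw [← Nat.cofinite_eq_atTop]; exact hyperfilter_le_cofinite
  have hFk : F =ᵐ[volume] k := by
    filter_upwards [hae, hfall] with x hx hx2
    simp_rw [hx2] at hx
    exact tendsto_nhds_unique (hx.mono_left hle) (hfk x)
  have hkL : MemLp k 2 volume := (memLp_congr_ae hFk).1 (Lp.memLp F)
  have hfL : ∀ n, MemLp (f n) 2 volume := fun n => (memLp_congr_ae (hFf n)).1 (Lp.memLp _)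
  have hkb : ∀ x, 0 < x → ‖k x‖ ^ 2 ≤ M * x := fun x hx => wv_bound H hHh hHM x hx
  have hfb : ∀ n x, 0 < x → ‖f n x‖ ^ 2 ≤ M * x := fun n x hx => by
    rw [hfg]; exact wv_bound _ (hG n) (hGM n) x hx
  have hae' : ∀ᵐ x, Tendsto (fun n => f n x) atTop (𝓝 (k x)) := by
    filter_upwards [hae, hfall, hFk] with x hx hx2 hx3
    simp_rw [hx2, hx3] at hx
    exact hx
  have hL : Tendsto (fun n => eLpNorm (f n - k) 2 volume) atTop (𝓝 0) := by
    have := (Lp.tendsto_Lp_iff_tendsto_eLpNorm' _ _).1 hlim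
    refine this.congr fun n => ?_
    exact eLpNorm_congr_ae ((hFf n).sub hFk)
  have e1 : ∀ u : ℝ → ℂ, (fun ω : ℝ => ‖u ω‖ ^ 2 / ω) = fun ω => 1 / ω * ‖u ω‖ ^ 2 :=
    fun u => by funext ω; ring
  have e2 : ∀ u : ℝ → ℂ, (fun ω : ℝ => Real.log ω * ‖u ω‖ ^ 2 / ω) =
      fun ω => Real.log ω / ω * ‖u ω‖ ^ 2 := fun u => by funext ω; ring
  have e2' : ∀ u : ℝ → ℂ, (fun ω : ℝ => (-Real.log ω) * ‖u ω‖ ^ 2 / ω) =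
      fun ω => -(Real.log ω / ω * ‖u ω‖ ^ 2) := fun u => by funext ω; ring
  have e3 : ∀ u : ℝ → ℂ, (fun ω : ℝ => ENNReal.ofReal ((Real.log ω) ^ 2 * ‖u ω‖ ^ 2 / ω)) =
      fun ω => ENNReal.ofReal ((Real.log ω) ^ 2 / ω * ‖u ω‖ ^ 2) := fun u => by
    funext ω; congr 1; ring
  have eq : ∀ u : ℝ → ℂ, MemLp u 2 volume → (∀ x, 0 < x → ‖u x‖ ^ 2 ≤ M * x) →
      ((∫⁻ ω in Set.Ioi (0:ℝ), ENNReal.ofReal ((Real.log ω) ^ 2 * ‖u ω‖ ^ 2 / ω)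
          ≤ ENNReal.ofReal (M * (∫ ω in Set.Ioi (0:ℝ), ‖u ω‖ ^ 2 / ω) +
              (∫ ω in Set.Ioi (0:ℝ), (-Real.log ω) * ‖u ω‖ ^ 2 / ω) ^ 2)) ↔
        ∫ ω in Set.Ioi (0:ℝ), (Real.log ω) ^ 2 / ω * ‖u ω‖ ^ 2 ≤
          M * (∫ ω in Set.Ioi (0:ℝ), 1 / ω * ‖u ω‖ ^ 2) +
            (∫ ω in Set.Ioi (0:ℝ), Real.log ω / ω * ‖u ω‖ ^ 2) ^ 2) := by
    intro u hu hub
    rw [e1, e2', e3, integral_neg, neg_sq, ← ofReal_integral_eq_lintegral_ofReal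
      (wv_int wv_w_sq hu hub), ENNReal.ofReal_le_ofReal_iff]
    · have : 0 ≤ ∫ ω in Set.Ioi (0:ℝ), 1 / ω * ‖u ω‖ ^ 2 := by
        refine setIntegral_nonneg measurableSet_Ioi fun x hx => ?_
        have : 0 < x := hx
        positivity
      positivity
    · filter_upwards [ae_restrict_mem measurableSet_Ioi] with x hx
      have : 0 < x := hx
      simp only [Pi.zero_apply]
      positivity
  refine ⟨k, h, hFk, hk0, hhi, fun x => rfl, hhL.restrict _, ?_, ?_, ?_⟩
  · rw [← wv_norm_sq H hHh]; exact hHM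
  · rw [e2]; exact wv_int wv_w_log hkL hkb
  · rw [eq k hkL hkb]
    have hv := fun n => (eq (f n) (hfL n) (hfb n)).1 (hvar n)
    exact le_of_tendsto_of_tendsto' (wv_tendsto wv_w_sq hkL hkb hfL hfb hae' hL)
      (((wv_tendsto wv_w_inv hkL hkb hfL hfb hae' hL).const_mul M).add
        ((wv_tendsto wv_w_log hkL hkb hfL hfb hae' hL).pow 2)) hv
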